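/- Let p and q be distinct primes with p ≥ 11 and q ≥ 11, and let x, y be nonzero integers with x^p − y^q = 1. Then |x| ≥ p^{q−1} − 1, |x| ≥ q^{p−1} + q, |y| ≥ q^{p−1} − 1, and |y| ≥ p^{q−1} + p. -/

import Mathlib

open Finset

lemma geo_fact (q : ℕ) (Y : ℤ) : ∃ H : ℤ, ∑ i ∈ range q, Y ^ i = q + (Y - 1) * H ∧
    (Odd q → (q : ℤ) ∣ Y - 1 → (q : ℤ) ∣ H) := by
  refine ⟨∑ i ∈ range q, ∑ j ∈ range i, Y ^ j, ?_, ?_⟩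
  · rw [mul_sum]
    have : ∀ i ∈ range q, (Y - 1) * ∑ j ∈ range i, Y ^ j = Y ^ i - 1 := by
      intro i _
      rw [mul_comm, geom_sum_mul]
    rw [sum_congr rfl this]
    simp
  · intro hq h
    have hY : Y ≡ 1 [ZMOD q] := (Int.modEq_iff_dvd.2 (by simpa using (dvd_neg.2 h)))
    have h1 : ∑ i ∈ range q, ∑ j ∈ range i, Y ^ j ≡ ∑ i ∈ range q, ∑ j ∈ range i, (1:ℤ) [ZMOD q] := by
      apply Int.ModEq.sum
      intro i _
      apply Int.ModEq.sum
      intro j _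
      simpa using hY.pow j
    apply (Int.modEq_zero_iff_dvd).1
    refine h1.trans ?_
    apply (Int.modEq_zero_iff_dvd).2
    obtain ⟨k, rfl⟩ := hq
    have := Finset.sum_range_id_mul_two (2 * k + 1)
    simp only [sum_const, card_range, nsmul_eq_mul, mul_one]
    rw [← Nat.cast_sum]
    refine Int.natCast_dvd_natCast.2 ⟨k, ?_⟩
    simp at this ⊢
    nlinarith

lemma cas_coprime (p q : ℕ) (hp : Odd p) (hq : q.Prime) (hq2 : Odd q) (x y : ℤ)
    (h : x ^ p - y ^ q = 1) (hx : ¬ (q : ℤ) ∣ x) : ∃ b : ℤ, y + 1 = b ^ p := by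
  obtain ⟨H, hH, -⟩ := geo_fact q (-y)
  have hg := geom_sum_mul (-y) q
  rw [hq2.neg_pow] at hg
  set G := ∑ i ∈ range q, (-y) ^ i
  have e : (y + 1) * G = x ^ p := by linarith
  have hc : IsCoprime (y + 1) G := by
    have hqp : Prime (q : ℤ) := Nat.prime_iff_prime_int.1 hq
    have : IsCoprime (q : ℤ) (y + 1) := by
      rw [hqp.coprime_iff_not_dvd]
      intro hd
      exact hx (hqp.dvd_of_dvd_pow (e ▸ Dvd.dvd.mul_right hd G))
    rw [hH, show (q : ℤ) + (-y - 1) * H = q + (y + 1) * (-H) by ring]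
    exact IsCoprime.add_mul_left_right this.symm (-H)
  exact Int.eq_pow_of_mul_eq_pow_odd_left hc hp e

lemma cas_div (p q : ℕ) (hp : Odd p) (hq : q.Prime) (hq2 : Odd q) (x y : ℤ)
    (h : x ^ p - y ^ q = 1) (hx : (q : ℤ) ∣ x) : ∃ b u : ℤ, y + 1 = q ^ (p - 1) * b ^ p ∧
      0 < u ∧ (y + 1) * (q * u ^ p) = x ^ p ∧ x = q * b * u ∧ u ^ p ≡ 1 [ZMOD q ^ (p - 1)] := by
  have hqp : Prime (q : ℤ) := Nat.prime_iff_prime_int.1 hq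
  have hp0 : p ≠ 0 := by rintro rfl; simp at hp
  have hq0 : (q : ℤ) ≠ 0 := hqp.ne_zero
  obtain ⟨H, hH, hH'⟩ := geo_fact q (-y)
  have hg := geom_sum_mul (-y) q
  have hGpos : 0 < ∑ i ∈ range q, (-y) ^ i := hq2.geom_sum_pos
  rw [hq2.neg_pow] at hg
  set G := ∑ i ∈ range q, (-y) ^ i
  have e : (y + 1) * G = x ^ p := by linarith
  have hd : (q : ℤ) ∣ y + 1 := by
    have := Fact.mk hq
    have h1 : (((x ^ p - y ^ q : ℤ)) : ZMod q) = 1 := by rw [h]; simp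
    have hx0 : (x : ZMod q) = 0 := (ZMod.intCast_zmod_eq_zero_iff_dvd _ _).2 hx
    push_cast at h1
    rw [hx0, zero_pow hp0, ZMod.pow_card] at h1
    rw [← ZMod.intCast_zmod_eq_zero_iff_dvd]
    push_cast
    linear_combination -h1
  obtain ⟨k, hk⟩ := hH' hq2 (by rw [show -y - 1 = -(y + 1) by ring]; exact dvd_neg.2 hd)
  subst hk
  obtain ⟨x', rfl⟩ := hx
  set g := 1 + (y + 1) * (-k) with hgdef
  have hGg : G = q * g := by rw [hH, hgdef]; ring
  have hgc : IsCoprime (y + 1) g := by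
    rw [hgdef]; exact IsCoprime.add_mul_left_right isCoprime_one_right _
  have e2 : (y + 1) * g = q ^ (p - 1) * x' ^ p := by
    have : (q : ℤ) ^ p = q ^ (p - 1) * q := by rw [pow_sub_one_mul hp0]
    rw [hGg, mul_pow, this] at e
    apply mul_left_cancel₀ hq0
    linarith
  have hqg : IsCoprime ((q : ℤ) ^ (p - 1)) g := (hgc.of_isCoprime_of_dvd_left hd).pow_left
  obtain ⟨w, hw⟩ : (q : ℤ) ^ (p - 1) ∣ y + 1 := hqg.dvd_of_dvd_mul_right ⟨_, e2⟩
  have e3 : w * g = x' ^ p := by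
    apply mul_left_cancel₀ (pow_ne_zero (p - 1) hq0)
    rw [← e2, hw]; ring
  have hwg : IsCoprime w g := hgc.of_isCoprime_of_dvd_left ⟨_, by rw [hw, mul_comm]⟩
  obtain ⟨b, hb⟩ := Int.eq_pow_of_mul_eq_pow_odd_left hwg hp e3
  obtain ⟨u, hu⟩ := Int.eq_pow_of_mul_eq_pow_odd_left hwg.symm hp (by rw [mul_comm, e3])
  have hgpos : 0 < g := by
    rw [hGg] at hGpos
    exact pos_of_mul_pos_right hGpos (by positivity)
  refine ⟨b, u, by rw [hw, hb], ?_, ?_, ?_, ?_⟩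
  · rw [hu] at hgpos
    exact hp.pow_pos_iff.1 hgpos
  · rw [← hu, ← hGg, e]
  · have : x' ^ p = (b * u) ^ p := by rw [← e3, hb, hu, mul_pow]
    rw [hp.strictMono_pow.injective this]; ring
  · rw [← hu, hgdef]
    apply Int.ModEq.symm
    rw [Int.modEq_iff_dvd]
    exact ⟨w * (-k), by rw [hw]; ring⟩

lemma cas_lower (p q : ℕ) (hp : p.Prime) (hpo : Odd p) (hq : q.Prime) (hq2 : Odd q) (hq11 : 11 ≤ q)
    (hp11 : 11 ≤ p) (hlt : q < p) (x y : ℤ) (hx0 : x ≠ 0)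
    (h : x ^ p - y ^ q = 1) (hx : (q : ℤ) ∣ x) : (q : ℤ) ^ p + q ≤ |x| := by
  obtain ⟨b, u, h1, h2, h3, h4, h5⟩ := cas_div p q hpo hq hq2 x y h hx
  have hb : b ≠ 0 := by rintro rfl; simp at h4; exact hx0 h4
  have hy1 : (y + 1) ≠ 0 := by
    intro h0; rw [h0, zero_mul] at h3; exact hx0 (pow_eq_zero_iff (by omega) |>.1 h3.symm)
  have hu : u ≡ 1 [ZMOD (q : ℤ) ^ (p - 1)] := by
    have h5' : ((u : ZMod (q ^ (p - 1)))) ^ p = 1 := by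
      have := (ZMod.intCast_eq_intCast_iff (u ^ p) 1 (q ^ (p - 1))).2 (by exact_mod_cast h5)
      simpa using this
    have hcard : Nat.Coprime p (Nat.totient (q ^ (p - 1))) := by
      rw [Nat.totient_prime_pow hq (by omega)]
      apply Nat.Coprime.mul_right
      · exact Nat.Coprime.pow_right _ ((Nat.coprime_primes hp hq).2 (by omega))
      · rw [hp.coprime_iff_not_dvd]
        intro hd
        have := Nat.le_of_dvd (by omega) hd
        omega
    have : NeZero (q ^ (p - 1)) := ⟨pow_ne_zero _ hq.ne_zero⟩
    have hunit : IsUnit (u : ZMod (q ^ (p - 1))) := IsUnit.of_pow_eq_one h5' (by omega)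
    obtain ⟨v, hv⟩ := hunit
    have hv1 : v ^ p = 1 := by
      apply Units.ext; push_cast; rw [hv, h5']
    have hv2 : v ^ (Nat.totient (q ^ (p - 1))) = 1 := ZMod.pow_totient v
    have := Nat.dvd_gcd (orderOf_dvd_of_pow_eq_one hv1) (orderOf_dvd_of_pow_eq_one hv2)
    have hv3 : v = 1 := by rwa [hcard.gcd_eq_one, Nat.dvd_one, orderOf_eq_one_iff] at this
    have := (ZMod.intCast_eq_intCast_iff u 1 (q ^ (p - 1))).1 (by rw [← hv, hv3]; simp)
    exact_mod_cast this
  have hu1 : u ≠ 1 := by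
    rintro rfl
    simp only [one_pow, mul_one] at h3
    have hyq : y ^ q = (y + 1) * q - 1 := by linarith
    have hbig : (q:ℤ) ≤ |y + 1| := by
      rw [h1, abs_mul, abs_pow, abs_pow, Nat.abs_cast]
      have : 1 ≤ |b| ^ p := one_le_pow₀ (Int.one_le_abs hb)
      have h' : (q : ℤ) ≤ q ^ (p - 1) := le_self_pow₀ (by norm_cast; omega) (by omega)
      nlinarith
    have hy2 : (2:ℤ) ≤ |y| := by
      have := abs_add_le y 1
      simp at this
      have : (11:ℤ) ≤ q := by exact_mod_cast hq11
      linarith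
    have h6 : |y| ^ q ≤ q * |y| + q + 1 := by
      rw [← abs_pow, hyq]
      calc |(y + 1) * q - 1| ≤ |(y+1) * q| + |1| := abs_sub _ _
        _ = |y + 1| * q + 1 := by rw [abs_mul, Nat.abs_cast]; simp
        _ ≤ (|y| + 1) * q + 1 := by gcongr; simpa using abs_add_le y 1
        _ = _ := by ring
    have h7 : |y| ^ q = |y| * |y| ^ (q - 1) := by rw [mul_pow_sub_one (by omega)]
    have h8 : (2:ℤ) ^ (q - 1) ≤ |y| ^ (q - 1) := by gcongr
    have h9 : ∀ n : ℕ, 11 ≤ n → (4 * n : ℤ) ≤ 2 ^ (n - 1) := by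
      intro n hn
      induction n, hn using Nat.le_induction with
      | base => norm_num
      | succ n hn ih =>
        have : (2:ℤ) ^ (n + 1 - 1) = 2 * 2 ^ (n - 1) := by
          rw [← pow_succ']; congr 1; omega
        rw [this]; push_cast; linarith
    have := h9 q hq11
    have hq' : (11:ℤ) ≤ q := by exact_mod_cast hq11
    nlinarith
  have hu2 : (q : ℤ) ^ (p - 1) + 1 ≤ u := by
    have := Int.le_of_dvd (by omega) (Int.modEq_iff_dvd.1 hu.symm)
    linarith
  rw [h4, abs_mul, abs_mul, Nat.abs_cast, abs_of_pos h2]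
  have hb1 := Int.one_le_abs hb
  calc (q : ℤ) ^ p + q = q * 1 * (q ^ (p - 1) + 1) := by
        rw [mul_one, mul_add, mul_pow_sub_one (by omega), mul_one]
    _ ≤ q * |b| * u := by gcongr

lemma cas_first (p q : ℕ) (hpo : Odd p) (hq : q.Prime) (hq2 : Odd q)
    (hlt : q < p) (x y : ℤ) (hx0 : x ≠ 0) (hy0 : y ≠ 0)
    (h : x ^ p - y ^ q = 1) : (q : ℤ) ∣ x := by
  by_contra hx
  obtain ⟨b, hb⟩ := cas_coprime p q hpo hq hq2 x y h hx
  have hq3 := hq.two_le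
  obtain rfl : y = b ^ p - 1 := by linarith
  have hmono := hpo.strictMono_pow (R := ℤ)
  have hmq := hq2.strictMono_pow (R := ℤ)
  rcases lt_trichotomy b 0 with hb0 | rfl | hb0
  · obtain ⟨c, rfl⟩ : ∃ c, b = -c := ⟨-b, by ring⟩
    obtain ⟨z, rfl⟩ : ∃ z, x = -z := ⟨-x, by ring⟩
    have hc : 1 ≤ c := by linarith
    rw [hpo.neg_pow, hpo.neg_pow, show -c ^ p - 1 = -(c ^ p + 1) by ring, hq2.neg_pow] at h
    have e : z ^ p = (c ^ p + 1) ^ q - 1 := by linarith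
    have hcp : 1 ≤ c ^ p := one_le_pow₀ hc
    have hcq : 1 ≤ c ^ q := one_le_pow₀ hc
    have l1 : c ^ q < z := by
      apply hmono.lt_iff_lt.1
      show (c ^ q) ^ p < z ^ p
      rw [e, ← pow_mul, mul_comm q p, pow_mul]
      have : (c ^ p) ^ q + 1 < (c ^ p + 1) ^ q := by
        obtain ⟨k, rfl⟩ : ∃ k, q = k + 2 := ⟨q - 2, by omega⟩
        have : (c ^ p) ^ (k + 1) ≤ (c ^ p + 1) ^ (k + 1) := by gcongr; linarith
        have h3 : 1 ≤ (c ^ p) ^ (k + 1) := one_le_pow₀ hcp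
        have h5 : 2 ≤ (c ^ p + 1) ^ (k + 1) := by
          have := le_self_pow₀ (show 1 ≤ c ^ p + 1 by linarith) (show k + 1 ≠ 0 by omega)
          linarith
        rw [pow_succ, pow_succ (c ^ p + 1)]
        nlinarith
      linarith
    have l2 : z < c ^ q + 1 := by
      apply hmono.lt_iff_lt.1
      show z ^ p < (c ^ q + 1) ^ p
      rw [e]
      suffices h : (c ^ p + 1) ^ q ≤ (c ^ q + 1) ^ p by linarith
      have h1 : (c ^ p + 1) ≤ c ^ (p - q) * (c ^ q + 1) := by
        have : 1 ≤ c ^ (p - q) := one_le_pow₀ hc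
        have : c ^ (p - q) * c ^ q = c ^ p := by rw [← pow_add]; congr 1; omega
        nlinarith
      calc (c ^ p + 1) ^ q ≤ (c ^ (p - q) * (c ^ q + 1)) ^ q := by gcongr
        _ = (c ^ q) ^ (p - q) * (c ^ q + 1) ^ q := by
          rw [mul_pow, ← pow_mul, ← pow_mul, mul_comm q]
        _ ≤ (c ^ q + 1) ^ (p - q) * (c ^ q + 1) ^ q := by gcongr; linarith
        _ = (c ^ q + 1) ^ p := by rw [← pow_add]; congr 1; omega
    linarith
  · rw [zero_pow (by omega)] at h
    rw [zero_sub, hq2.neg_pow, one_pow] at h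
    exact hx0 (pow_eq_zero_iff (n := p) (by omega) |>.1 (by linarith))
  · have hb1 : b ≠ 1 := by rintro rfl; simp at hy0
    have hb2 : 2 ≤ b := by omega
    have e : x ^ p = (b ^ p - 1) ^ q + 1 := by linarith
    have hbq : 2 ≤ b ^ q := hb2.trans (le_self_pow₀ (by omega) (by omega))
    have hbp : 2 ≤ b ^ p := hb2.trans (le_self_pow₀ (by omega) (by omega))
    have l1 : x < b ^ q := by
      apply hmono.lt_iff_lt.1
      show x ^ p < (b ^ q) ^ p
      rw [e, ← pow_mul, mul_comm q p, pow_mul]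
      obtain ⟨k, rfl⟩ : ∃ k, q = k + 2 := ⟨q - 2, by omega⟩
      have h1 : (b ^ p - 1) ^ (k + 1) ≤ (b ^ p) ^ (k + 1) := by gcongr <;> linarith
      have h2 : b ^ p ≤ (b ^ p) ^ (k + 1) := le_self_pow₀ (by linarith) (by omega)
      rw [pow_succ, pow_succ (b ^ p)]
      nlinarith
    have l2 : b ^ q - 1 < x := by
      apply hmono.lt_iff_lt.1
      show (b ^ q - 1) ^ p < x ^ p
      rw [e]
      suffices h : (b ^ q - 1) ^ p ≤ (b ^ p - 1) ^ q by linarith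
      have h1 : b ^ (p - q) * (b ^ q - 1) ≤ b ^ p - 1 := by
        have : 1 ≤ b ^ (p - q) := one_le_pow₀ (by linarith)
        have : b ^ (p - q) * b ^ q = b ^ p := by rw [← pow_add]; congr 1; omega
        nlinarith
      have h0 : 0 ≤ b ^ q - 1 := by linarith
      calc (b ^ q - 1) ^ p = (b ^ q - 1) ^ (p - q) * (b ^ q - 1) ^ q := by
            rw [← pow_add]; congr 1; omega
        _ ≤ (b ^ q) ^ (p - q) * (b ^ q - 1) ^ q := by gcongr; linarith
        _ = (b ^ (p - q) * (b ^ q - 1)) ^ q := by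
          rw [mul_pow, ← pow_mul, ← pow_mul, mul_comm q]
        _ ≤ _ := by gcongr
    linarith

lemma fact_choose {R : Type*} [CommRing R] [BinomialRing R] (r : R) (k : ℕ) :
    (k.factorial : R) * Ring.choose r k = ∏ i ∈ range k, (r - i) := by
  rw [← nsmul_eq_mul, ← Ring.descPochhammer_eq_factorial_smul_choose]
  induction k with
  | zero => simp
  | succ k ih =>
    rw [prod_range_succ, ← ih, descPochhammer_succ_right, Polynomial.smeval_mul,
      Polynomial.smeval_sub, Polynomial.smeval_X, Polynomial.smeval_natCast]
    simp

lemma dvd_prod_sub (p q r k : ℕ) (hr : r ∣ k.factorial) (hc : Nat.Coprime q r) :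
    (r : ℤ) ∣ ∏ i ∈ range k, ((p : ℤ) - i * q) := by
  obtain ⟨s, t, hst⟩ := (Nat.isCoprime_iff_coprime.2 hc)
  have hs : IsCoprime (r : ℤ) (s ^ k) := by
    apply IsCoprime.pow_right
    exact ⟨t, q, by linarith⟩
  apply hs.dvd_of_dvd_mul_left
  have h1 : (s ^ k) * ∏ i ∈ range k, ((p : ℤ) - i * q) ≡ ∏ i ∈ range k, (s * p - (i : ℤ)) [ZMOD r] := by
    rw [show s ^ k = ∏ i ∈ range k, s by simp, ← prod_mul_distrib]
    apply Int.ModEq.prod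
    intro i _
    apply Int.ModEq.symm
    rw [Int.modEq_iff_dvd]
    exact ⟨t * i, by linear_combination (-i : ℤ) * hst⟩
  apply Int.modEq_zero_iff_dvd.1
  refine h1.trans (Int.modEq_zero_iff_dvd.2 ?_)
  rw [← fact_choose]
  exact Dvd.dvd.mul_right (by exact_mod_cast hr) _

lemma coef_int (p q : ℕ) (hp : p.Prime) (hq : q.Prime) (hpq : p ≠ q) (k : ℕ) :
    ∃ c : ℤ, (q : ℚ) ^ (k + k.factorial.factorization q) * Ring.choose (p / q : ℚ) k = c ∧
      ¬ (q : ℤ) ∣ c := by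
  have hqp : Prime (q : ℤ) := Nat.prime_iff_prime_int.1 hq
  have hq0 : (q : ℚ) ≠ 0 := by exact_mod_cast hq.ne_zero
  set v := k.factorial.factorization q
  set r := k.factorial / q ^ v with hr
  have hvr : q ^ v * r = k.factorial := Nat.ordProj_mul_ordCompl_eq_self _ _
  have hcop : Nat.Coprime q r := Nat.coprime_ordCompl hq (Nat.factorial_ne_zero k)
  have hr0 : r ≠ 0 := by
    intro h0; rw [h0, mul_zero] at hvr; exact Nat.factorial_ne_zero k hvr.symm
  obtain ⟨c, hc⟩ := dvd_prod_sub p q r k ⟨q ^ v, by rw [← hvr, mul_comm]⟩ hcop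
  refine ⟨c, ?_, ?_⟩
  · have h1 := fact_choose (p / q : ℚ) k
    have h2 : (q : ℚ) ^ k * ∏ i ∈ range k, ((p / q : ℚ) - i) = r * c := by
      have := congrArg (fun z : ℤ => (z : ℚ)) hc
      push_cast at this
      rw [← this, show (q : ℚ) ^ k = ∏ i ∈ range k, (q : ℚ) by rw [prod_const, card_range], ← prod_mul_distrib]
      apply prod_congr rfl
      intro i _
      field_simp
    rw [← h1, ← hvr] at h2
    push_cast at h2
    have : (r : ℚ) ≠ 0 := by exact_mod_cast hr0
    apply mul_left_cancel₀ this
    rw [← h2, pow_add]; ring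
  · intro hd
    have : (q : ℤ) ∣ ∏ i ∈ range k, ((p : ℤ) - i * q) := by
      rw [hc]; exact Dvd.dvd.mul_left hd _
    obtain ⟨i, _, hi⟩ := (hqp.dvd_finsetProd_iff _).1 this
    have h3 : (q : ℤ) ∣ p := by
      have := dvd_add hi (Dvd.intro_left (i : ℤ) rfl)
      simpa using this
    have := (Nat.prime_dvd_prime_iff_eq hq hp).1 (by exact_mod_cast h3)
    exact hpq this.symm

lemma coef_bd (r : ℚ) (m k : ℕ) (h1 : (m : ℚ) - 1 ≤ r) (h2 : r ≤ m) (hk : k ≤ m) :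
    0 ≤ Ring.choose r k ∧ Ring.choose r k ≤ m.choose k := by
  have hf : (0 : ℚ) < k.factorial := by exact_mod_cast Nat.factorial_pos k
  have hi : ∀ i ∈ range k, 0 ≤ r - i := by
    intro i hi
    have : i + 1 ≤ m := by have := mem_range.1 hi; omega
    have : (i : ℚ) + 1 ≤ m := by exact_mod_cast this
    linarith
  constructor
  · apply nonneg_of_mul_nonneg_right _ hf
    rw [fact_choose]
    exact prod_nonneg hi
  · rw [← Ring.choose_natCast (R := ℚ)]
    apply le_of_mul_le_mul_left _ hf
    rw [fact_choose, fact_choose]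
    exact prod_le_prod hi (fun i _ => by linarith)

open Polynomial in
lemma trunc_bd (p q m : ℕ) (hq : 0 < q) (h1 : (m : ℚ) - 1 ≤ p / q) (h2 : (p / q : ℚ) ≤ m) (t : ℚ)
    (ht : |t| ≤ 1) :
    |(1 + t) ^ p - (∑ k ∈ range (m + 1), Ring.choose (p / q : ℚ) k * t ^ k) ^ q| ≤
      |t| ^ (m + 1) * (2 ^ p + 2 ^ (m * q)) := by
  set f := PowerSeries.binomialSeries ℚ (p / q : ℚ) with hf
  have hfq : ∀ n : ℕ, PowerSeries.binomialSeries ℚ (n * (p / q) : ℚ) = f ^ n := by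
    intro n
    induction n with
    | zero => simp
    | succ n ih => rw [pow_succ, ← ih, hf, ← PowerSeries.binomialSeries_add]; congr 1; push_cast; ring
  have hfq' : f ^ q = (((1 + X : ℚ[X]) ^ p : ℚ[X]) : PowerSeries ℚ) := by
    rw [← hfq, mul_div_cancel₀ _ (by exact_mod_cast hq.ne'), PowerSeries.binomialSeries_nat]
    simp
  set P := PowerSeries.trunc (m + 1) f with hP
  have hPc : ∀ k, P.coeff k = if k < m + 1 then Ring.choose (p / q : ℚ) k else 0 := by
    intro k; rw [hP, PowerSeries.coeff_trunc, hf]; simp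
  have hPe : ∀ s : ℚ, P.eval s = ∑ k ∈ range (m + 1), Ring.choose (p / q : ℚ) k * s ^ k := by
    intro s
    rw [Polynomial.eval_eq_sum_range' (n := m + 1)]
    · apply sum_congr rfl
      intro k hk
      rw [hPc, if_pos (mem_range.1 hk)]
    · exact PowerSeries.natDegree_trunc_lt f m
  have hP0 : ∀ k, 0 ≤ P.coeff k := by
    intro k; rw [hPc]; split_ifs with h
    · exact (coef_bd _ m k h1 h2 (by omega)).1
    · exact le_rfl
  have hPq0 : ∀ n k, 0 ≤ (P ^ n).coeff k := by
    intro n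
    induction n with
    | zero => intro k; rw [pow_zero, coeff_one]; split_ifs <;> norm_num
    | succ n ih =>
      intro k
      rw [pow_succ, coeff_mul]
      exact sum_nonneg fun i _ => mul_nonneg (ih _) (hP0 _)
  have hP1 : (P ^ q).eval 1 ≤ 2 ^ (m * q) := by
    rw [eval_pow, pow_mul, hPe]
    gcongr
    · apply sum_nonneg
      intro k hk
      simpa using (coef_bd _ m k h1 h2 (by have := mem_range.1 hk; omega)).1
    · calc _ ≤ ∑ k ∈ range (m + 1), (m.choose k : ℚ) := by
            apply sum_le_sum
            intro k hk
            simpa using (coef_bd _ m k h1 h2 (by have := mem_range.1 hk; omega)).2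
        _ = 2 ^ m := by exact_mod_cast Nat.sum_range_choose m
  set Q := (1 + X : ℚ[X]) ^ p with hQ
  have hQ1 : Q.eval 1 = 2 ^ p := by rw [hQ]; simp; norm_num
  have hQ0 : ∀ k, 0 ≤ Q.coeff k := by
    intro k; rw [hQ, coeff_one_add_X_pow]; positivity
  have hz : ∀ k < m + 1, (Q - P ^ q).coeff k = 0 := by
    intro k hk
    have := PowerSeries.trunc_trunc_pow f (m + 1) q
    rw [hfq'] at this
    have := congrArg (fun z => Polynomial.coeff z k) this
    simp only [PowerSeries.coeff_trunc, if_pos hk] at this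
    rw [coeff_sub, sub_eq_zero]
    rw [← hP, ← Polynomial.coe_pow, Polynomial.coeff_coe, Polynomial.coeff_coe] at this
    exact this.symm
  have hev : (1 + t) ^ p - (∑ k ∈ range (m + 1), Ring.choose (p / q : ℚ) k * t ^ k) ^ q
      = (Q - P ^ q).eval t := by
    rw [← hPe, eval_sub, hQ]; simp
  rw [hev]
  set L := Q.natDegree + (P ^ q).natDegree + 1
  have hL : (Q - P ^ q).natDegree < L := by
    have := natDegree_sub_le Q (P ^ q)
    omega
  rw [eval_eq_sum_range' hL]
  calc _ ≤ ∑ i ∈ range L, |(Q - P ^ q).coeff i * t ^ i| := abs_sum_le_sum_abs _ _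
    _ ≤ ∑ i ∈ range L, |t| ^ (m + 1) * (Q.coeff i * 1 ^ i + (P ^ q).coeff i * 1 ^ i) := by
      apply sum_le_sum
      intro i _
      rw [abs_mul, abs_pow]
      by_cases hi : i < m + 1
      · rw [hz i hi]
        have := hQ0 i
        have := hPq0 q i
        simp; positivity
      · rw [mul_comm]
        have a1 : |t| ^ i ≤ |t| ^ (m + 1) := pow_le_pow_of_le_one (abs_nonneg _) ht (by omega)
        have a2 : |(Q - P ^ q).coeff i| ≤ Q.coeff i * 1 ^ i + (P ^ q).coeff i * 1 ^ i := by
          rw [coeff_sub, one_pow, mul_one, mul_one]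
          refine (abs_sub _ _).trans ?_
          rw [abs_of_nonneg (hQ0 i), abs_of_nonneg (hPq0 q i)]
        gcongr
    _ = |t| ^ (m + 1) * (Q.eval 1 + (P ^ q).eval 1) := by
      rw [← mul_sum, sum_add_distrib, ← eval_eq_sum_range' (by omega), ← eval_eq_sum_range' (by omega)]
    _ ≤ _ := by rw [hQ1]; gcongr

lemma pow_diff (q : ℕ) (hq : Odd q) (hq2 : 2 ≤ q) (M N : ℤ) (h : M ≠ N) :
    |M| ^ (q - 1) ≤ |M ^ q - N ^ q| := by
  have key : ∀ M N : ℤ, 0 ≤ M → M ≠ N → M ^ (q - 1) ≤ |M ^ q - N ^ q| := by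
    intro M N hM h
    have hm := hq.strictMono_pow (R := ℤ)
    rcases lt_or_gt_of_ne h with h | h
    · have h1 : (M + 1) ^ q ≤ N ^ q := hm.monotone (by omega : M + 1 ≤ N)
      have h2 : (M + 1) * M ^ (q - 1) ≤ (M + 1) ^ q := by
        rw [← mul_pow_sub_one (by omega : q ≠ 0) (M + 1)]
        gcongr; omega
      have h3 : M ^ q = M * M ^ (q - 1) := by rw [mul_pow_sub_one (by omega : q ≠ 0)]
      rw [abs_sub_comm]
      refine le_trans ?_ (le_abs_self _)
      linarith
    · rcases hM.eq_or_lt with rfl | hM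
      · rw [zero_pow (by omega)]; positivity
      have h1 : N ^ q ≤ (M - 1) ^ q := hm.monotone (by omega : N ≤ M - 1)
      have h2 : (M - 1) ^ q ≤ (M - 1) * M ^ (q - 1) := by
        rw [← mul_pow_sub_one (by omega : q ≠ 0) (M - 1)]
        have : 0 ≤ M - 1 := by omega
        gcongr; omega
      have h3 : M ^ q = M * M ^ (q - 1) := by rw [mul_pow_sub_one (by omega : q ≠ 0)]
      refine le_trans ?_ (le_abs_self _)
      linarith
  rcases le_total 0 M with hM | hM
  · rw [abs_of_nonneg hM]; exact key M N hM h
  · rw [abs_of_nonpos hM]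
    have := key (-M) (-N) (by omega) (by omega)
    rwa [hq.neg_pow, hq.neg_pow, ← neg_sub', abs_neg] at this

lemma num_bd (p q d m : ℕ) (hq : 11 ≤ q) (hlt : q < p) (hd : 10 * d ≤ p + 10) (hm : m * q ≤ p + q) :
    (2 * q ^ d * (2 ^ p + 2 ^ (m * q) + 1) : ℚ) < q ^ p := by
  have h1 : (2 ^ p + 2 ^ (m * q) + 1 : ℚ) ≤ 2 ^ (2 * p) := by
    have a : (2:ℚ) ^ (m * q) ≤ 2 ^ (2 * p - 1) := pow_le_pow_right₀ (by norm_num) (by omega)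
    have b : (2:ℚ) ^ p ≤ 2 ^ (2 * p - 2) := pow_le_pow_right₀ (by norm_num) (by omega)
    have c : (1:ℚ) ≤ 2 ^ (2 * p - 2) := one_le_pow₀ (by norm_num)
    have e1 : (2:ℚ) ^ (2 * p - 1) = 2 ^ (2 * p - 2) * 2 := by rw [← pow_succ]; congr 1; omega
    have e2 : (2:ℚ) ^ (2 * p) = 2 ^ (2 * p - 2) * 4 := by
      rw [show (4:ℚ) = 2 ^ 2 by norm_num, ← pow_add]; congr 1; omega
    linarith
  have hq' : (8:ℚ) ≤ q := by exact_mod_cast (by omega : 8 ≤ q)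
  have h2 : (2:ℚ) * 2 ^ (2 * p) < q ^ (p - d) := by
    calc (2:ℚ) * 2 ^ (2 * p) = 2 ^ (2 * p + 1) := by rw [pow_succ]; ring
      _ < 2 ^ (3 * (p - d)) := pow_lt_pow_right₀ (by norm_num) (by omega)
      _ = 8 ^ (p - d) := by rw [pow_mul]; norm_num
      _ ≤ q ^ (p - d) := by gcongr
  have hqd : (0:ℚ) < q ^ d := by positivity
  calc (2 * q ^ d * (2 ^ p + 2 ^ (m * q) + 1) : ℚ) ≤ 2 * q ^ d * 2 ^ (2 * p) := by gcongr
    _ = q ^ d * (2 * 2 ^ (2 * p)) := by ring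
    _ < q ^ d * q ^ (p - d) := by gcongr
    _ = q ^ p := by rw [← pow_add]; congr 1; omega

lemma cas_second (p q : ℕ) (hp : p.Prime) (hpo : Odd p) (hq : q.Prime) (hq2 : Odd q) (hq11 : 11 ≤ q)
    (hlt : q < p) (a x y : ℤ) (hbig : (q : ℤ) ^ p + q ≤ |x|) (ha : x - 1 = a ^ q)
    (h : x ^ p - y ^ q = 1) : False := by
  have hqZ : Prime (q : ℤ) := Nat.prime_iff_prime_int.1 hq
  choose c hc hc' using coef_int p q hp hq (by omega)
  set v : ℕ → ℕ := fun k => k.factorial.factorization q with hv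
  have hvm : ∀ k m, k ≤ m → v k ≤ v m := by
    intro k m hkm
    exact (Nat.factorization_le_iff_dvd (Nat.factorial_ne_zero _) (Nat.factorial_ne_zero _)).2
      (Nat.factorial_dvd_factorial hkm) q
  set m := p / q + 1 with hm
  have hmq1 : p < m * q := by
    have := Nat.lt_mul_div_succ p hq.pos
    rw [mul_comm]; exact this
  have hmq2 : m * q ≤ p + q := by
    have := Nat.div_mul_le_self p q
    rw [hm, add_mul]; omega
  have hm1 : 1 ≤ m := Nat.succ_le_succ (Nat.zero_le _)
  have hmp : m + 1 ≤ p := by nlinarith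
  clear_value m
  have hd : 10 * (m + v m) ≤ p + 10 := by
    have := Fact.mk hq
    have h1 := sub_one_mul_padicValNat_factorial_lt_of_ne_zero (p := q) (n := m) (by omega)
    have h2 : padicValNat q m.factorial = v m := (Nat.factorization_def _ hq).symm
    rw [h2] at h1
    obtain ⟨e, he⟩ : ∃ e, q = e + 1 := ⟨q - 1, by omega⟩
    obtain ⟨g, hg⟩ : ∃ g, m + v m = g + 1 := ⟨m + v m - 1, by omega⟩
    rw [he] at h1 hmq2
    simp only [Nat.add_sub_cancel] at h1
    have h3 : e * (m + v m) + 1 ≤ p + e + 1 := by nlinarith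
    rw [hg] at h3 ⊢
    have : e * g ≤ p := by nlinarith
    have : 10 * g ≤ e * g := Nat.mul_le_mul_right _ (by omega)
    omega
  set d := m + v m with hdd
  have hnum := num_bd p q d m hq11 hlt hd hmq2
  -- integers
  set N : ℤ := ∑ k ∈ range (m + 1), (q : ℤ) ^ (d - (k + v k)) * c k * (a ^ q) ^ (m - k) with hN
  set M : ℤ := (q : ℤ) ^ d * a ^ (m * q - p) * y with hM
  have hMN : M ≠ N := by
    intro e
    have hMd : (q : ℤ) ∣ M := by
      rw [hM, mul_assoc]; exact Dvd.dvd.mul_right (dvd_pow_self _ (by omega)) _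
    rw [e, hN, sum_range_succ] at hMd
    have hsum : (q : ℤ) ∣ ∑ k ∈ range m, (q : ℤ) ^ (d - (k + v k)) * c k * (a ^ q) ^ (m - k) := by
      apply dvd_sum
      intro k hk
      have hk' := mem_range.1 hk
      have := hvm k m hk'.le
      rw [mul_assoc]; exact Dvd.dvd.mul_right (dvd_pow_self _ (by omega)) _
    have := (dvd_add_right hsum).1 hMd
    rw [hdd] at this
    simp at this
    exact hc' m this
  have hlow := pow_diff q hq2 hq.two_le M N hMN
  -- rational computations
  have hq0 : (0 : ℚ) < q := by exact_mod_cast hq.pos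
  have hq1 : (1 : ℚ) ≤ q := by exact_mod_cast hq.one_le
  have hA : (q : ℚ) ^ p ≤ |(a : ℚ) ^ q| := by
    have h1 : (q : ℤ) ^ p ≤ |a ^ q| := by
      rw [← ha]
      have := abs_sub_abs_le_abs_sub x 1
      have : (11 : ℤ) ≤ q := by exact_mod_cast hq11
      simp at *
      linarith
    exact_mod_cast h1
  set X : ℚ := (a : ℚ) ^ q with hX
  have hApos : 0 < |X| := lt_of_lt_of_le (by positivity) hA
  have hX0 : X ≠ 0 := abs_pos.1 hApos
  set t := X⁻¹ with ht
  have hst : |t| = |X|⁻¹ := by rw [ht, abs_inv]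
  have hp2 : (2 * (p + 1) : ℚ) ≤ |X| := by
    refine le_trans ?_ hA
    have h1 : 2 * (p + 1) ≤ q ^ p := by
      calc 2 * (p + 1) ≤ 2 * 2 ^ p := by have := Nat.lt_two_pow_self (n := p); omega
        _ = 2 ^ (p + 1) := by rw [pow_succ]; ring
        _ ≤ 2 ^ (2 * p) := Nat.pow_le_pow_right (by norm_num) (by omega)
        _ = 4 ^ p := by rw [pow_mul]; norm_num
        _ ≤ q ^ p := Nat.pow_le_pow_left (by omega) _
    exact_mod_cast h1
  have hpQ : (0:ℚ) ≤ p := by positivity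
  have hs : |t| * (2 * (p + 1)) ≤ 1 := by
    rw [hst, inv_mul_le_iff₀ hApos]; linarith
  have hs0 : 0 < |t| := by rw [hst]; positivity
  have hs1 : |t| ≤ 1 := by nlinarith
  have hr1 : (m : ℚ) - 1 ≤ p / q := by
    rw [le_div_iff₀ hq0, hm]
    have := Nat.div_mul_le_self p q
    push_cast
    have : ((p / q : ℕ) : ℚ) * q ≤ p := by exact_mod_cast this
    linarith
  have hr2 : (p / q : ℚ) ≤ m := by
    rw [div_le_iff₀ hq0]; exact_mod_cast hmq1.le
  have htr := trunc_bd p q m hq.pos hr1 hr2 t hs1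
  set S := ∑ k ∈ range (m + 1), Ring.choose (p / q : ℚ) k * t ^ k with hS
  set D : ℚ := (q : ℚ) ^ d with hD
  have hDpos : 0 < D := by positivity
  have hNQ : (N : ℚ) = D * X ^ m * S := by
    rw [hN, hS, mul_sum]
    push_cast
    apply sum_congr rfl
    intro k hk
    have hk' : k ≤ m := by have := mem_range.1 hk; omega
    have := hvm k m hk'
    rw [← hc k, hD, ht, inv_pow]
    have e1 : (q : ℚ) ^ d = q ^ (d - (k + v k)) * q ^ (k + v k) := by
      rw [← pow_add]; congr 1; omega
    have e2 : X ^ m = X ^ (m - k) * X ^ k := by rw [← pow_add]; congr 1; omega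
    rw [e1, e2]
    have hXk : X ^ k ≠ 0 := pow_ne_zero _ hX0
    simp only [hv]
    rw [← hX]
    field_simp
  have hMq : (M : ℚ) ^ q = (D * X ^ m) ^ q * ((1 + t) ^ p - t ^ p) := by
    have hy : (y : ℚ) ^ q = (X + 1) ^ p - 1 := by
      have : y ^ q = (a ^ q + 1) ^ p - 1 := by rw [← ha]; ring_nf; ring_nf at h; linarith
      rw [hX]; exact_mod_cast this
    have e3 : (1 + t) ^ p - t ^ p = ((X + 1) ^ p - 1) / X ^ p := by
      rw [ht, show 1 + X⁻¹ = (X + 1) / X by field_simp, div_pow, inv_pow]; field_simp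
    have e4 : (X ^ m) ^ q = X ^ (m * q - p) * X ^ p := by
      rw [← pow_mul, ← pow_add]; congr 1; omega
    rw [hM, e3, mul_pow, e4]
    push_cast
    rw [mul_pow, mul_pow, hy, hX, ← pow_mul, ← pow_mul, ← pow_mul, ← pow_mul, mul_comm (m * q - p) q]
    have : (a:ℚ) ≠ 0 := by
      intro h0; apply hX0; rw [hX, h0, zero_pow hq.ne_zero]
    field_simp
  have hhalf : 1 / 2 ≤ (1 + t) ^ p - t ^ p := by
    have h1 := one_add_mul_le_pow (a := t) (by have := neg_abs_le t; linarith) p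
    have h2 : t ^ p ≤ |t| := by
      calc t ^ p ≤ |t ^ p| := le_abs_self _
        _ = |t| ^ p := abs_pow _ _
        _ ≤ |t| := pow_le_of_le_one (abs_nonneg _) hs1 hp.ne_zero
    have h3 := neg_abs_le t
    nlinarith
  set B := |D * X ^ m| with hB
  have hBe : B = D * |X| ^ m := by rw [hB, abs_mul, abs_pow X, abs_of_pos hDpos]
  have hBpos : 0 < B := by rw [hBe]; positivity
  have hMlow : B ^ (q - 1) * (1 / 2) ≤ |(M : ℚ)| ^ (q - 1) := by
    have h1 : B ^ q * (1 / 2) ≤ |(M:ℚ)| ^ q := by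
      rw [← abs_pow (M : ℚ), hMq, abs_mul, abs_pow (D * X ^ m), ← hB]
      gcongr
      exact hhalf.trans (le_abs_self _)
    rcases le_total B |(M : ℚ)| with h2 | h2
    · have : B ^ (q - 1) ≤ |(M : ℚ)| ^ (q - 1) := by gcongr
      have : 0 < B ^ (q - 1) := by positivity
      linarith
    · apply le_of_mul_le_mul_left _ hBpos
      calc B * (B ^ (q - 1) * (1 / 2)) = B ^ q * (1 / 2) := by
            rw [← mul_assoc, mul_pow_sub_one hq.ne_zero]
        _ ≤ _ := h1
        _ = |(M:ℚ)| * |(M:ℚ)| ^ (q - 1) := by rw [mul_pow_sub_one hq.ne_zero]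
        _ ≤ _ := by gcongr
  have hup : |(M : ℚ) ^ q - (N : ℚ) ^ q| ≤ B ^ q * (|t| ^ (m + 1) * (2 ^ p + 2 ^ (m * q) + 1)) := by
    rw [hMq, hNQ, mul_pow _ S, ← mul_sub, abs_mul, abs_pow (D * X ^ m), ← hB]
    gcongr
    calc |(1 + t) ^ p - t ^ p - S ^ q| = |((1 + t) ^ p - S ^ q) - t ^ p| := by congr 1; ring
      _ ≤ |(1 + t) ^ p - S ^ q| + |t ^ p| := abs_sub _ _
      _ ≤ |t| ^ (m + 1) * (2 ^ p + 2 ^ (m * q)) + |t| ^ (m + 1) := by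
        gcongr
        rw [abs_pow]
        exact pow_le_pow_of_le_one (abs_nonneg _) hs1 hmp
      _ = _ := by ring
  have hlowQ : |(M : ℚ)| ^ (q - 1) ≤ |(M : ℚ) ^ q - (N : ℚ) ^ q| := by exact_mod_cast hlow
  have hfin := (hMlow.trans hlowQ).trans hup
  have hfin2 : 1 / 2 ≤ B * (|t| ^ (m + 1) * (2 ^ p + 2 ^ (m * q) + 1)) := by
    apply le_of_mul_le_mul_left _ (pow_pos hBpos (q - 1))
    refine hfin.trans (le_of_eq ?_)
    rw [← pow_sub_one_mul hq.ne_zero B]; ring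
  have hfin3 : B * (|t| ^ (m + 1) * (2 ^ p + 2 ^ (m * q) + 1)) = D * (2 ^ p + 2 ^ (m * q) + 1) / |X| := by
    rw [hBe, hst, inv_pow, pow_succ]; field_simp
  rw [hfin3, le_div_iff₀ hApos] at hfin2
  linarith

lemma main_lt (p q : ℕ) (hp : p.Prime) (hq : q.Prime) (hlt : q < p)
    (hq11 : 11 ≤ q) (x y : ℤ) (hx : x ≠ 0) (hy : y ≠ 0)
    (h : x ^ p - y ^ q = 1) :
    (p : ℤ) ^ (q - 1) - 1 ≤ |x| ∧ (q : ℤ) ^ (p - 1) + q ≤ |x| ∧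
      (q : ℤ) ^ (p - 1) - 1 ≤ |y| ∧ (p : ℤ) ^ (q - 1) + p ≤ |y| := by
  have hpo : Odd p := hp.odd_of_ne_two (by omega)
  have hqo : Odd q := hq.odd_of_ne_two (by omega)
  have hqx := cas_first p q hpo hq hqo hlt x y hx hy h
  have hbig := cas_lower p q hp hpo hq hqo hq11 (by omega) hlt x y hx h hqx
  have h' : (-y) ^ q - (-x) ^ p = 1 := by rw [hqo.neg_pow, hpo.neg_pow]; linarith
  have hpy : (p : ℤ) ∣ -y := by
    by_contra hd
    obtain ⟨b, hb⟩ := cas_coprime q p hqo hp hpo (-y) (-x) h' hd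
    exact cas_second p q hp hpo hq hqo hq11 hlt (-b) x y hbig
      (by rw [hqo.neg_pow, ← hb]; ring) h
  obtain ⟨b, u, hb1, -, -, hb2, -⟩ := cas_div p q hpo hq hqo x y h hqx
  obtain ⟨a, w, ha1, -, -, ha2, -⟩ := cas_div q p hqo hp hpo (-y) (-x) h' hpy
  have hb0 : b ≠ 0 := by rintro rfl; simp at hb2; exact hx hb2
  have ha0 : a ≠ 0 := by rintro rfl; simp at ha2; exact hy ha2
  have aux : ∀ (r s : ℕ) (b z : ℤ), b ≠ 0 → z + 1 = (r : ℤ) ^ (s - 1) * b ^ s →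
      (r : ℤ) ^ (s - 1) - 1 ≤ |z| := by
    intro r s b z hb hz
    have h1 : (r : ℤ) ^ (s - 1) ≤ |z + 1| := by
      rw [hz, abs_mul, abs_pow, abs_pow, Nat.abs_cast]
      exact le_mul_of_one_le_right (by positivity) (one_le_pow₀ (Int.one_le_abs hb))
    have := abs_add_le z 1
    simp at this
    linarith
  have c1 := aux p q a (-x) ha0 ha1
  rw [abs_neg] at c1
  have c3 := aux q p b y hb0 hb1
  have hqZ : (11 : ℤ) ≤ q := by exact_mod_cast hq11
  have c2 : (q : ℤ) ^ (p - 1) + q ≤ |x| := by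
    have : (q : ℤ) ^ (p - 1) ≤ q ^ p := pow_le_pow_right₀ (by linarith) (by omega)
    linarith
  refine ⟨c1, c2, c3, ?_⟩
  by_contra! hcon
  have hpZ : (12 : ℤ) ≤ p := by exact_mod_cast (by omega : 12 ≤ p)
  set W : ℤ := (p : ℤ) ^ (q - 1) - 1 with hW
  have hW1 : (2 : ℤ) ^ q ≤ W ∧ (p : ℤ) * p - 1 ≤ W := by
    constructor
    · have h1 : (4 : ℤ) ^ (q - 1) ≤ p ^ (q - 1) := by gcongr; linarith
      have h2 : (4 : ℤ) ^ (q - 1) = 2 ^ (2 * (q - 1)) := by rw [pow_mul]; norm_num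
      have h3 : (2 : ℤ) ^ (q + 1) ≤ 2 ^ (2 * (q - 1)) := pow_le_pow_right₀ (by norm_num) (by omega)
      have h4 : (2 : ℤ) ^ (q + 1) = 2 ^ q * 2 := pow_succ _ _
      have h5 : (1 : ℤ) ≤ 2 ^ q := one_le_pow₀ (by norm_num)
      linarith
    · have h1 : (p : ℤ) ^ 2 ≤ p ^ (q - 1) := pow_le_pow_right₀ (by linarith) (by omega)
      nlinarith
  obtain ⟨hW2, hW3⟩ := hW1
  have hW0 : 2 ≤ W := by nlinarith
  have hy2 : |y| ≤ 2 * W := by nlinarith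
  have e1 : |y| ^ q ≤ W ^ (q + 1) := by
    calc |y| ^ q ≤ (2 * W) ^ q := by gcongr
      _ = 2 ^ q * W ^ q := mul_pow _ _ _
      _ ≤ W * W ^ q := by gcongr
      _ = _ := by rw [pow_succ]; ring
  have hpq2 : q + 2 ≤ p := by
    obtain ⟨i, rfl⟩ := hpo
    obtain ⟨j, rfl⟩ := hqo
    omega
  have e2 : W ^ (q + 2) ≤ |x| ^ p := by
    calc W ^ (q + 2) ≤ W ^ p := pow_le_pow_right₀ (by linarith) hpq2
      _ ≤ _ := by gcongr
  have e3 : |x| ^ p ≤ |y| ^ q + 1 := by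
    rw [← abs_pow, ← abs_pow, show x ^ p = y ^ q + 1 by linarith]
    simpa using abs_add_le (y ^ q) 1
  have e4 : W ^ (q + 2) = W * W ^ (q + 1) := by rw [pow_succ']
  have e5 : 2 ≤ W ^ (q + 1) := hW0.trans (le_self_pow₀ (by linarith) (by omega))
  nlinarith

/-- Lower bounds for a solution of the Catalan equation: if `p, q` are distinct primes
`≥ 11` and `x, y` nonzero integers with `x ^ p - y ^ q = 1`, then
`|x| ≥ p^(q-1) - 1`, `|x| ≥ q^(p-1) + q`, `|y| ≥ q^(p-1) - 1` and `|y| ≥ p^(q-1) + p`. -/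
theorem catalan_solution_size (p q : ℕ) (hp : p.Prime) (hq : q.Prime) (hpq : p ≠ q)
    (hp11 : 11 ≤ p) (hq11 : 11 ≤ q) (x y : ℤ) (hx : x ≠ 0) (hy : y ≠ 0)
    (h : x ^ p - y ^ q = 1) :
    (p : ℤ) ^ (q - 1) - 1 ≤ |x| ∧ (q : ℤ) ^ (p - 1) + q ≤ |x| ∧
      (q : ℤ) ^ (p - 1) - 1 ≤ |y| ∧ (p : ℤ) ^ (q - 1) + p ≤ |y| := by
  rcases lt_or_gt_of_ne hpq with hlt | hlt
  · have hpo : Odd p := hp.odd_of_ne_two (by omega)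
    have hqo : Odd q := hq.odd_of_ne_two (by omega)
    have h' : (-y) ^ q - (-x) ^ p = 1 := by rw [hqo.neg_pow, hpo.neg_pow]; linarith
    have := main_lt q p hq hp hlt hp11 (-y) (-x) (by simpa using hy) (by simpa using hx) h'
    rw [abs_neg, abs_neg] at this
    exact ⟨this.2.2.1, this.2.2.2, this.1, this.2.1⟩
  · exact main_lt p q hp hq hlt hq11 x y hx hy h
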